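/- arXiv:cond-mat/9610166 — 2 statements merged into one kernel-verified Lean document; each statement's English description precedes it below -/
import Mathlib

section
/- Hopf–Cole solution of the Burgers equation in arbitrary dimension: the vector field v(x,t) := ∇_x(−2ν ln b₀(x,t)) is smooth on ℝ^d × (0,∞) and solves the Burgers equation ∂_t v + (v·∇)v = ν Δ v there; moreover, if Θ₀ is continuously differentiable, then v(x,t) → ∇Θ₀(x) as t → 0⁺ for every x ∈ ℝ^d. -/
open MeasureTheory Real Filter Set

noncomputable section

/-- `Ed d` is the Euclidean space `ℝ^d`. -/
abbrev Ed (d : ℕ) : Type := EuclideanSpace ℝ (Fin d)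

/-- `Φ(x,y,t) = ‖x−y‖²/(2t) + Θ₀(y)`. -/
def Phi {d : ℕ} (Θ₀ : Ed d → ℝ) (x y : Ed d) (t : ℝ) : ℝ :=
  ‖x - y‖ ^ 2 / (2 * t) + Θ₀ y

/-- `b₀(x,t) = (4πνt)^{−d/2} ∫ exp(−Φ(x,y,t)/(2ν)) dy`. -/
def b0 {d : ℕ} (ν : ℝ) (Θ₀ : Ed d → ℝ) (x : Ed d) (t : ℝ) : ℝ :=
  (4 * π * ν * t) ^ (-(d : ℝ) / 2) * ∫ y, Real.exp (-Phi Θ₀ x y t / (2 * ν))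

/-- `a₀(x,t) = (4πνt)^{−d/2} ∫ C₀(y) exp(−Φ(x,y,t)/(2ν)) dy`. -/
def a0 {d : ℕ} (ν : ℝ) (Θ₀ C₀ : Ed d → ℝ) (x : Ed d) (t : ℝ) : ℝ :=
  (4 * π * ν * t) ^ (-(d : ℝ) / 2) * ∫ y, C₀ y * Real.exp (-Phi Θ₀ x y t / (2 * ν))

/-- `f(x)/‖x‖² → 0` as `‖x‖ → ∞`. -/
def SubQuadratic {d : ℕ} (f : Ed d → ℝ) : Prop :=
  Tendsto (fun x => f x / ‖x‖ ^ 2) (cocompact (Ed d)) (nhds 0)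

/-- Spatial Laplacian `Δf(x) = ∑ᵢ ∂²f/∂xᵢ²`. -/
def lap {d : ℕ} (f : Ed d → ℝ) (x : Ed d) : ℝ :=
  ∑ i : Fin d, fderiv ℝ (fun y => fderiv ℝ f y (EuclideanSpace.single i 1)) x
    (EuclideanSpace.single i 1)


open scoped Topology

/-- Continuous functions growing slower than every Gaussian. -/
def SG {d : ℕ} {H : Type} [NormedAddCommGroup H] (h : Ed d → H) : Prop :=
  Continuous h ∧ ∀ ε : ℝ, 0 < ε → ∃ C : ℝ, 0 ≤ C ∧ ∀ y, ‖h y‖ ≤ C * Real.exp (ε * ‖y‖ ^ 2)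

/-- The linear phase. -/
def phs {d : ℕ} (y : Ed d) : (Ed d × ℝ) →L[ℝ] ℝ :=
  (innerSL ℝ y).comp (ContinuousLinearMap.fst ℝ (Ed d) ℝ)
    - (‖y‖ ^ 2) • ContinuousLinearMap.snd ℝ (Ed d) ℝ

/-- Laplace-type transform. -/
def II {d : ℕ} {H : Type} [NormedAddCommGroup H] [NormedSpace ℝ H] (h : Ed d → H)
    (p : Ed d × ℝ) : H := ∫ y, Real.exp (phs y p) • h y

lemma phs_apply {d : ℕ} (y : Ed d) (p : Ed d × ℝ) :
    phs y p = inner ℝ y p.1 - ‖y‖ ^ 2 * p.2 := by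
  simp [phs]

lemma phs_cont {d : ℕ} : Continuous (fun y : Ed d => phs y) := by
  unfold phs
  fun_prop

lemma integrable_gauss {d : ℕ} {c : ℝ} (hc : 0 < c) :
    Integrable (fun y : Ed d => Real.exp (-c * ‖y‖ ^ 2)) := by
  have h := (GaussianFourier.integrable_cexp_neg_mul_sq_norm_add (V := Ed d) (b := (c : ℂ))
    (by simpa using hc) 0 0).norm
  refine h.congr (Eventually.of_forall fun y => ?_)
  simp only [Complex.norm_exp]
  norm_num [← Complex.ofReal_pow]

lemma integrable_of_gauss {d : ℕ} {H : Type} [NormedAddCommGroup H] {f : Ed d → H}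
    (hf : AEStronglyMeasurable f volume) {c C : ℝ} (hc : 0 < c)
    (hb : ∀ y, ‖f y‖ ≤ C * Real.exp (-c * ‖y‖ ^ 2)) : Integrable f :=
  ((integrable_gauss hc).const_mul C).mono' hf (Eventually.of_forall hb)

lemma sq_le_exp_sq (ε r : ℝ) (hε : 0 < ε) : r ^ 2 ≤ ε⁻¹ * Real.exp (ε * r ^ 2) := by
  have := Real.add_one_le_exp (ε * r ^ 2)
  rw [inv_mul_eq_div, le_div_iff₀ hε]
  linarith

lemma phs_norm_le {d : ℕ} (y : Ed d) : ‖phs y‖ ≤ 1 + 2 * ‖y‖ ^ 2 := by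
  refine ContinuousLinearMap.opNorm_le_bound _ (by positivity) fun p => ?_
  rw [phs_apply]
  have h1 : |inner ℝ y p.1| ≤ ‖y‖ * ‖p.1‖ := abs_real_inner_le_norm _ _
  have h2 : ‖p.1‖ ≤ ‖p‖ := norm_fst_le p
  have h3 : |p.2| ≤ ‖p‖ := norm_snd_le p
  have h4 : ‖y‖ ≤ 1 + ‖y‖ ^ 2 := by nlinarith [sq_nonneg (‖y‖ - 1)]
  have h5 := norm_nonneg y
  calc ‖inner ℝ y p.1 - ‖y‖ ^ 2 * p.2‖ ≤ |inner ℝ y p.1| + |‖y‖ ^ 2 * p.2| := norm_sub_le _ _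
    _ ≤ ‖y‖ * ‖p‖ + ‖y‖ ^ 2 * ‖p‖ := by
        rw [abs_mul, abs_of_nonneg (sq_nonneg ‖y‖)]
        gcongr
        exact h1.trans (by gcongr)
    _ ≤ (1 + ‖y‖ ^ 2) * ‖p‖ + ‖y‖ ^ 2 * ‖p‖ := by gcongr
    _ = _ := by ring

lemma SG.mul_sq {d : ℕ} {H H' : Type} [NormedAddCommGroup H] [NormedAddCommGroup H']
    {h : Ed d → H} (hh : SG h)
    {k : Ed d → H'} (hk : Continuous k) (hb : ∀ y, ‖k y‖ ≤ ‖h y‖ * (1 + 2 * ‖y‖ ^ 2)) : SG k := by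
  refine ⟨hk, fun ε hε => ?_⟩
  obtain ⟨C, hC, hC'⟩ := hh.2 (ε / 2) (by positivity)
  refine ⟨C * (1 + 2 * (ε / 2)⁻¹), by positivity, fun y => (hb y).trans ?_⟩
  have h1 := sq_le_exp_sq (ε / 2) ‖y‖ (by positivity)
  have h2 : (1 : ℝ) ≤ Real.exp (ε / 2 * ‖y‖ ^ 2) := Real.one_le_exp (by positivity)
  calc ‖h y‖ * (1 + 2 * ‖y‖ ^ 2)
      ≤ (C * Real.exp (ε / 2 * ‖y‖ ^ 2)) * (Real.exp (ε / 2 * ‖y‖ ^ 2)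
          + 2 * ((ε / 2)⁻¹ * Real.exp (ε / 2 * ‖y‖ ^ 2))) := by
        gcongr
        exact hC' y
    _ = C * (1 + 2 * (ε / 2)⁻¹) * (Real.exp (ε / 2 * ‖y‖ ^ 2) * Real.exp (ε / 2 * ‖y‖ ^ 2)) := by
        ring
    _ = _ := by rw [← Real.exp_add]; congr 2; ring

lemma phs_bound {d : ℕ} {H : Type} [NormedAddCommGroup H] {h : Ed d → H} (hh : SG h)
    {s R : ℝ} (hs : 0 < s) :
    ∃ C : ℝ, ∀ y, ∀ p : Ed d × ℝ, ‖p.1‖ ≤ R → s ≤ p.2 →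
      Real.exp (phs y p) * ‖h y‖ ≤ C * Real.exp (-(s / 2) * ‖y‖ ^ 2) := by
  obtain ⟨C, hC, hC'⟩ := hh.2 (s / 4) (by positivity)
  refine ⟨Real.exp (R ^ 2 / s) * C, fun y p h1 h2 => ?_⟩
  have h3 : phs y p ≤ R ^ 2 / s + (-(3 * s / 4) * ‖y‖ ^ 2) := by
    rw [phs_apply]
    have h4 : inner ℝ y p.1 ≤ ‖y‖ * R :=
      (real_inner_le_norm _ _).trans (by gcongr)
    have h5 : ‖y‖ * R ≤ R ^ 2 / s + s / 4 * ‖y‖ ^ 2 := by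
      have : 0 ≤ (R - s / 2 * ‖y‖) ^ 2 / s := by positivity
      have h6 : (R - s / 2 * ‖y‖) ^ 2 / s = R ^ 2 / s + s / 4 * ‖y‖ ^ 2 - ‖y‖ * R := by
        field_simp; ring
      linarith
    have h7 : ‖y‖ ^ 2 * s ≤ ‖y‖ ^ 2 * p.2 := by gcongr
    linarith
  calc Real.exp (phs y p) * ‖h y‖
      ≤ Real.exp (R ^ 2 / s + (-(3 * s / 4) * ‖y‖ ^ 2)) * (C * Real.exp (s / 4 * ‖y‖ ^ 2)) := by
        gcongr
        exact hC' y
    _ = Real.exp (R ^ 2 / s) * C *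
        (Real.exp (-(3 * s / 4) * ‖y‖ ^ 2) * Real.exp (s / 4 * ‖y‖ ^ 2)) := by
        rw [Real.exp_add]; ring
    _ = _ := by rw [← Real.exp_add]; congr 2; ring

lemma II_meas {d : ℕ} {H : Type} [NormedAddCommGroup H] [NormedSpace ℝ H] {h : Ed d → H}
    (hh : SG h) (p : Ed d × ℝ) : Continuous (fun y => Real.exp (phs y p) • h y) := by
  have h1 := hh.1
  have h2 := phs_cont (d := d)
  fun_prop

lemma II_integrable {d : ℕ} {H : Type} [NormedAddCommGroup H] [NormedSpace ℝ H] {h : Ed d → H}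
    (hh : SG h) (p : Ed d × ℝ) (hp : 0 < p.2) :
    Integrable (fun y => Real.exp (phs y p) • h y) := by
  obtain ⟨C, hC⟩ := phs_bound hh (R := ‖p.1‖) hp
  refine integrable_of_gauss (II_meas hh p).aestronglyMeasurable (c := p.2 / 2) (C := C)
    (by positivity) fun y => ?_
  rw [norm_smul, Real.norm_of_nonneg (Real.exp_pos _).le]
  exact hC y p le_rfl le_rfl

lemma SG.phs {d : ℕ} {H : Type} [NormedAddCommGroup H] [NormedSpace ℝ H] {h : Ed d → H}
    (hh : SG h) : SG (fun y => (phs y).smulRight (h y)) := by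
  refine hh.mul_sq ?_ fun y => ?_
  · have h1 := hh.1
    have h2 := phs_cont (d := d)
    have : Continuous fun y => ContinuousLinearMap.smulRightL ℝ (Ed d × ℝ) H (_root_.phs y) (h y) := by
      fun_prop
    simpa using this
  · rw [ContinuousLinearMap.norm_smulRight_apply, mul_comm]
    gcongr
    exact phs_norm_le y

lemma II_hasFDerivAt {d : ℕ} {H : Type} [NormedAddCommGroup H] [NormedSpace ℝ H]
    {h : Ed d → H} (hh : SG h) (p : Ed d × ℝ) (hp : 0 < p.2) :
    HasFDerivAt (II h) (II (fun y => (phs y).smulRight (h y)) p) p := by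
  obtain ⟨C, hC⟩ := phs_bound hh.phs (R := ‖p.1‖ + 1) (half_pos hp)
  have hs : {q : Ed d × ℝ | ‖q.1‖ < ‖p.1‖ + 1 ∧ p.2 / 2 < q.2} ∈ 𝓝 p := by
    refine IsOpen.mem_nhds ?_ ⟨by simp, by simpa using hp⟩
    have h1 : IsOpen {q : Ed d × ℝ | ‖q.1‖ < ‖p.1‖ + 1} := isOpen_lt (by fun_prop) (by fun_prop)
    have h2 : IsOpen {q : Ed d × ℝ | p.2 / 2 < q.2} := isOpen_lt (by fun_prop) (by fun_prop)
    exact h1.inter h2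
  refine hasFDerivAt_integral_of_dominated_of_fderiv_le (𝕜 := ℝ)
    (F := fun q y => Real.exp (phs y q) • h y)
    (F' := fun q y => Real.exp (phs y q) • (phs y).smulRight (h y))
    (bound := fun y => C * Real.exp (-(p.2 / 2 / 2) * ‖y‖ ^ 2)) hs
    (Eventually.of_forall fun q => (II_meas hh q).aestronglyMeasurable)
    (II_integrable hh p hp) (II_meas hh.phs p).aestronglyMeasurable ?_ ?_ ?_
  · refine Eventually.of_forall fun y q hq => ?_
    rw [norm_smul, Real.norm_of_nonneg (Real.exp_pos _).le]
    exact hC y q hq.1.le hq.2.le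
  · exact (integrable_gauss (by positivity)).const_mul C
  · refine Eventually.of_forall fun y q _ => ?_
    have := ((phs y).hasFDerivAt (x := q)).exp.smul_const (h y)
    convert! this using 1
    refine ContinuousLinearMap.ext fun v => ?_
    simp [mul_smul]

lemma U_open {d : ℕ} : IsOpen ((univ : Set (Ed d)) ×ˢ Ioi (0 : ℝ)) := isOpen_univ.prod isOpen_Ioi

lemma II_contDiffOn_nat {d : ℕ} (n : ℕ) : ∀ {H : Type} [NormedAddCommGroup H] [NormedSpace ℝ H]
    {h : Ed d → H}, SG h → ContDiffOn ℝ n (II h) (univ ×ˢ Ioi 0) := by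
  induction n with
  | zero =>
    intro H _ _ h hh
    rw [Nat.cast_zero, contDiffOn_zero]
    exact fun p hp => (II_hasFDerivAt hh p hp.2).continuousAt.continuousWithinAt
  | succ n ih =>
    intro H _ _ h hh
    rw [Nat.cast_succ, contDiffOn_succ_iff_fderiv_of_isOpen U_open]
    refine ⟨fun p hp => (II_hasFDerivAt hh p hp.2).differentiableAt.differentiableWithinAt,
      by simp, ?_⟩
    exact (ih hh.phs).congr fun p hp => (II_hasFDerivAt hh p hp.2).fderiv

lemma II_contDiffOn {d : ℕ} {H : Type} [NormedAddCommGroup H] [NormedSpace ℝ H]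
    {h : Ed d → H} (hh : SG h) : ContDiffOn ℝ (⊤ : ℕ∞) (II h) (univ ×ˢ Ioi 0) :=
  contDiffOn_infty.2 fun n => II_contDiffOn_nat n hh

lemma II_fderiv {d : ℕ} {h : Ed d → ℝ} (hh : SG h) (p : Ed d × ℝ) (hp : 0 < p.2)
    (v : Ed d × ℝ) : fderiv ℝ (II h) p v = II (fun y => phs y v * h y) p := by
  rw [(II_hasFDerivAt hh p hp).fderiv]
  unfold II
  rw [ContinuousLinearMap.integral_apply (II_integrable hh.phs p hp)]
  simp

lemma SG_g {d : ℕ} {ν : ℝ} (hν : 0 < ν) {Θ₀ : Ed d → ℝ} (hc : Continuous Θ₀)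
    (hq : SubQuadratic Θ₀) : SG (fun y => Real.exp (-Θ₀ y / (2 * ν))) := by
  refine ⟨by fun_prop, fun ε hε => ?_⟩
  have h1 : ∀ᶠ y in cocompact (Ed d), |Θ₀ y / ‖y‖ ^ 2| < 2 * ν * ε := by
    have := hq.abs
    rw [abs_zero] at this
    exact this.eventually_lt_const (by positivity)
  obtain ⟨K, hK, hK'⟩ := Filter.mem_cocompact.1 h1
  obtain ⟨M, hM⟩ := (hK.insert (0 : Ed d)).exists_bound_of_continuousOn hc.continuousOn
  refine ⟨Real.exp (M / (2 * ν)), (Real.exp_pos _).le, fun y => ?_⟩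
  rw [Real.norm_of_nonneg (Real.exp_pos _).le, ← Real.exp_add, Real.exp_le_exp]
  have hM0 : 0 ≤ M := (norm_nonneg _).trans (hM 0 (mem_insert _ _))
  by_cases hy : y ∈ insert (0 : Ed d) K
  · have h2 := hM y hy
    have h3 : -Θ₀ y ≤ M := (neg_le_abs _).trans h2
    have : -Θ₀ y / (2 * ν) ≤ M / (2 * ν) := by gcongr
    have : 0 ≤ ε * ‖y‖ ^ 2 := by positivity
    linarith
  · rw [mem_insert_iff, not_or] at hy
    have h2 : |Θ₀ y / ‖y‖ ^ 2| < 2 * ν * ε := hK' hy.2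
    have hy0 : 0 < ‖y‖ ^ 2 := by have := norm_pos_iff.2 hy.1; positivity
    rw [abs_div, abs_of_pos hy0, div_lt_iff₀ hy0] at h2
    have h3 : -Θ₀ y ≤ 2 * ν * ε * ‖y‖ ^ 2 := (neg_le_abs _).trans h2.le
    have h4 : -Θ₀ y / (2 * ν) ≤ ε * ‖y‖ ^ 2 := by
      rw [div_le_iff₀ (by positivity)]; linarith
    have : 0 ≤ M / (2 * ν) := by positivity
    linarith

lemma D_smooth {d : ℕ} {f : Ed d × ℝ → ℝ} (hf : ContDiffOn ℝ (⊤ : ℕ∞) f (univ ×ˢ Ioi 0))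
    (v : Ed d × ℝ) : ContDiffOn ℝ (⊤ : ℕ∞) (fun p => fderiv ℝ f p v) (univ ×ˢ Ioi 0) := by
  have := hf.fderiv_of_isOpen (m := (⊤ : ℕ∞)) U_open (by simp)
  exact this.clm_apply contDiffOn_const

lemma D_at {d : ℕ} {f : Ed d × ℝ → ℝ} (hf : ContDiffOn ℝ (⊤ : ℕ∞) f (univ ×ˢ Ioi 0))
    {p : Ed d × ℝ} (hp : 0 < p.2) : DifferentiableAt ℝ f p :=
  (hf.contDiffAt (U_open.mem_nhds ⟨mem_univ _, hp⟩)).differentiableAt (by simp)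

lemma D_comm {d : ℕ} {f : Ed d × ℝ → ℝ} (hf : ContDiffOn ℝ (⊤ : ℕ∞) f (univ ×ˢ Ioi 0))
    {p : Ed d × ℝ} (hp : 0 < p.2) (v w : Ed d × ℝ) :
    fderiv ℝ (fun q => fderiv ℝ f q v) p w = fderiv ℝ (fun q => fderiv ℝ f q w) p v := by
  have hpn := (U_open (d := d)).mem_nhds ⟨mem_univ p.1, hp⟩
  have h1 := (hf.contDiffAt hpn).isSymmSndFDerivAt
    (by simp only [minSmoothness_of_isRCLikeNormedField]; exact WithTop.coe_le_coe.2 (le_top : (2 : ℕ∞) ≤ ⊤))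
  have h2 : DifferentiableAt ℝ (fderiv ℝ f) p :=
    ((hf.fderiv_of_isOpen (m := (⊤ : ℕ∞)) U_open (by simp)).contDiffAt hpn).differentiableAt
      (by simp)
  have h3 : ∀ v, fderiv ℝ (fun q => fderiv ℝ f q v) p = (fderiv ℝ (fderiv ℝ f) p).flip v := by
    intro v
    rw [fderiv_clm_apply h2 (differentiableAt_const _)]
    simp
  rw [h3, h3]
  exact h1 w v

lemma D_congr {d : ℕ} {f g : Ed d × ℝ → ℝ} (h : ∀ p : Ed d × ℝ, 0 < p.2 → f p = g p)
    {p : Ed d × ℝ} (hp : 0 < p.2) : fderiv ℝ f p = fderiv ℝ g p := by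
  refine Filter.EventuallyEq.fderiv_eq ?_
  filter_upwards [(U_open (d := d)).mem_nhds ⟨mem_univ p.1, hp⟩] with q hq using h q hq.2

lemma slice_x {d : ℕ} {f : Ed d × ℝ → ℝ} (hf : ContDiffOn ℝ (⊤ : ℕ∞) f (univ ×ˢ Ioi 0))
    (x : Ed d) {t : ℝ} (ht : 0 < t) (v : Ed d) :
    fderiv ℝ (fun y => f (y, t)) x v = fderiv ℝ f (x, t) (v, 0) := by
  have h1 : HasFDerivAt f (fderiv ℝ f (x, t)) (x, t) := (D_at hf (p := (x, t)) ht).hasFDerivAt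
  have h2 := HasFDerivAt.comp (g := f) (f := fun y => (y, t)) x h1
    (hasFDerivAt_prodMk_left (𝕜 := ℝ) x t)
  have h3 : fderiv ℝ (fun y => f (y, t)) x = _ := h2.fderiv
  rw [h3]
  simp

lemma slice_t {d : ℕ} {f : Ed d × ℝ → ℝ} (hf : ContDiffOn ℝ (⊤ : ℕ∞) f (univ ×ˢ Ioi 0))
    (x : Ed d) {t : ℝ} (ht : 0 < t) :
    deriv (fun s => f (x, s)) t = fderiv ℝ f (x, t) (0, 1) := by
  have h1 : HasFDerivAt f (fderiv ℝ f (x, t)) (x, t) := (D_at hf (p := (x, t)) ht).hasFDerivAt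
  have h2 := h1.comp_hasDerivAt t ((hasDerivAt_const t x).prodMk (hasDerivAt_id t))
  exact h2.deriv

lemma gradient_coord {d : ℕ} (f : Ed d → ℝ) (x : Ed d) (i : Fin d) :
    gradient f x i = fderiv ℝ f x (EuclideanSpace.single i 1) := by
  have h : inner ℝ (gradient f x) (EuclideanSpace.single i (1 : ℝ)) = _ :=
    InnerProductSpace.toDual_symm_apply
  rw [← h, EuclideanSpace.inner_single_right]
  simp

/-- Basis direction in space-time. -/
abbrev ee {d : ℕ} (j : Fin d) : Ed d × ℝ := (EuclideanSpace.single j 1, 0)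

lemma HJ {d : ℕ} {ν : ℝ} (hν : 0 < ν) {u θ : Ed d × ℝ → ℝ}
    (hθ : ContDiffOn ℝ (⊤ : ℕ∞) θ (univ ×ˢ Ioi 0))
    (hu : ∀ p : Ed d × ℝ, 0 < p.2 → u p = Real.exp (-(2 * ν)⁻¹ * θ p))
    (heat : ∀ p : Ed d × ℝ, 0 < p.2 → fderiv ℝ u p (0, 1) =
      ν * ∑ j : Fin d, fderiv ℝ (fun q => fderiv ℝ u q (ee j)) p (ee j))
    (p : Ed d × ℝ) (hp : 0 < p.2) :
    fderiv ℝ θ p (0, 1) = ν * ∑ j : Fin d, fderiv ℝ (fun q => fderiv ℝ θ q (ee j)) p (ee j)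
      - 2⁻¹ * ∑ j : Fin d, (fderiv ℝ θ p (ee j)) ^ 2 := by
  have h1 : ∀ q : Ed d × ℝ, 0 < q.2 → ∀ v, fderiv ℝ u q v =
      -(2 * ν)⁻¹ * (Real.exp (-(2 * ν)⁻¹ * θ q) * fderiv ℝ θ q v) := by
    intro q hq v
    rw [D_congr hu hq, (((D_at hθ hq).hasFDerivAt.const_mul (-(2 * ν)⁻¹)).exp).fderiv]
    simp
    ring
  have h2 : ∀ j, fderiv ℝ (fun q => fderiv ℝ u q (ee j)) p (ee j) =
      -(2 * ν)⁻¹ * (Real.exp (-(2 * ν)⁻¹ * θ p) *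
        (fderiv ℝ (fun q => fderiv ℝ θ q (ee j)) p (ee j)
          - (2 * ν)⁻¹ * (fderiv ℝ θ p (ee j)) ^ 2)) := by
    intro j
    rw [D_congr (fun q hq => h1 q hq (ee j)) hp]
    have h3 := ((((D_at hθ hp).hasFDerivAt.const_mul (-(2 * ν)⁻¹)).exp).mul
      (D_at (D_smooth hθ (ee j)) hp).hasFDerivAt).const_mul (-(2 * ν)⁻¹)
    have h4 : fderiv ℝ (fun q => -(2 * ν)⁻¹ * (Real.exp (-(2 * ν)⁻¹ * θ q) *
      fderiv ℝ θ q (ee j))) p = _ := h3.fderiv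
    rw [h4]
    simp
    ring
  have h5 := heat p hp
  rw [h1 p hp] at h5
  simp only [h2] at h5
  rw [← Finset.mul_sum, ← Finset.mul_sum, Finset.sum_sub_distrib, ← Finset.mul_sum] at h5
  have h6 := (Real.exp_pos (-(2 * ν)⁻¹ * θ p)).ne'
  generalize Real.exp (-(2 * ν)⁻¹ * θ p) = e at *
  field_simp at h5 ⊢
  linarith

lemma burgers {d : ℕ} {ν : ℝ} {θ : Ed d × ℝ → ℝ}
    (hθ : ContDiffOn ℝ (⊤ : ℕ∞) θ (univ ×ˢ Ioi 0))
    (hj : ∀ p : Ed d × ℝ, 0 < p.2 → fderiv ℝ θ p (0, 1) =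
      ν * ∑ j : Fin d, fderiv ℝ (fun q => fderiv ℝ θ q (ee j)) p (ee j)
      - 2⁻¹ * ∑ j : Fin d, (fderiv ℝ θ p (ee j)) ^ 2)
    (p : Ed d × ℝ) (hp : 0 < p.2) (i : Fin d) :
    fderiv ℝ (fun q => fderiv ℝ θ q (ee i)) p (0, 1)
      + ∑ j : Fin d, fderiv ℝ θ p (ee j) * fderiv ℝ (fun q => fderiv ℝ θ q (ee i)) p (ee j)
      = ν * ∑ j : Fin d, fderiv ℝ (fun q' => fderiv ℝ (fun q => fderiv ℝ θ q (ee i)) q' (ee j))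
          p (ee j) := by
  have hA : ∀ j : Fin d, HasFDerivAt _ _ p := fun j =>
    (D_at (D_smooth (D_smooth hθ (ee j)) (ee j)) hp).hasFDerivAt
  have hB : ∀ j : Fin d, HasFDerivAt _ _ p := fun j =>
    (D_at (D_smooth hθ (ee j)) hp).hasFDerivAt.pow 2
  have h1 := ((HasFDerivAt.fun_sum (u := Finset.univ) fun j _ => hA j).const_mul ν).sub
    ((HasFDerivAt.fun_sum (u := Finset.univ) fun j _ => hB j).const_mul 2⁻¹)
  rw [D_comm hθ hp, D_congr hj hp]
  have h2 : fderiv ℝ (fun p => ν * ∑ j : Fin d, fderiv ℝ (fun q => fderiv ℝ θ q (ee j)) p (ee j)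
      - 2⁻¹ * ∑ j : Fin d, (fderiv ℝ θ p (ee j)) ^ 2) p = _ := h1.fderiv
  rw [h2]
  have h3 : ∀ j : Fin d,
      fderiv ℝ (fun q' => fderiv ℝ (fun q => fderiv ℝ θ q (ee i)) q' (ee j)) p (ee j)
      = fderiv ℝ (fun q' => fderiv ℝ (fun q => fderiv ℝ θ q (ee j)) q' (ee j)) p (ee i) := by
    intro j
    rw [D_congr (fun q hq => D_comm hθ hq (ee i) (ee j)) hp, D_comm (D_smooth hθ (ee j)) hp]
  simp only [h3, D_comm hθ hp (ee i)]
  simp [Finset.mul_sum]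
  rw [sub_add, sub_eq_self, sub_eq_zero]
  refine Finset.sum_congr rfl fun j _ => ?_
  ring

/-- Heat-type transform of `h`. -/
def JJ {d : ℕ} (ν : ℝ) (h : Ed d → ℝ) (p : Ed d × ℝ) : ℝ :=
  (4 * π * ν * p.2) ^ (-(d : ℝ) / 2) * Real.exp (-‖p.1‖ ^ 2 / (4 * ν * p.2)) *
    II h ((1 / (2 * ν * p.2)) • p.1, 1 / (4 * ν * p.2))

lemma JJ_eq {d : ℕ} {ν : ℝ} (hν : 0 < ν) (h : Ed d → ℝ) (x : Ed d) {t : ℝ} (ht : 0 < t) :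
    JJ ν h (x, t) = (4 * π * ν * t) ^ (-(d : ℝ) / 2) *
      ∫ y, h y * Real.exp (-‖x - y‖ ^ 2 / (4 * ν * t)) := by
  unfold JJ II
  rw [mul_assoc, ← integral_const_mul]
  congr 2
  ext y
  rw [smul_eq_mul, ← mul_assoc, ← Real.exp_add, mul_comm (h y)]
  congr 2
  rw [phs_apply, norm_sub_sq_real, inner_smul_right, real_inner_comm]
  field_simp
  ring

lemma b0_eq {d : ℕ} {ν : ℝ} (hν : 0 < ν) (Θ₀ : Ed d → ℝ) (x : Ed d) {t : ℝ} (ht : 0 < t) :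
    b0 ν Θ₀ x t = JJ ν (fun y => Real.exp (-Θ₀ y / (2 * ν))) (x, t) := by
  rw [JJ_eq hν _ _ ht]
  unfold b0 Phi
  congr 2
  ext y
  rw [← Real.exp_add]
  congr 1
  field_simp
  ring

lemma JJ_smooth {d : ℕ} {ν : ℝ} (hν : 0 < ν) {h : Ed d → ℝ} (hh : SG h) :
    ContDiffOn ℝ (⊤ : ℕ∞) (JJ ν h) (univ ×ˢ Ioi 0) := by
  unfold JJ
  have h0 : ∀ p ∈ (univ : Set (Ed d)) ×ˢ Ioi (0 : ℝ), 0 < p.2 := fun p hp => hp.2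
  have hn : ContDiff ℝ (⊤ : ℕ∞) (fun p : Ed d × ℝ => ‖p.1‖ ^ 2) :=
    (contDiff_norm_sq ℝ).comp contDiff_fst
  refine ContDiffOn.mul (ContDiffOn.mul ?_ ?_) ?_
  · refine ContDiffOn.rpow_const_of_ne (by fun_prop) fun p hp => ?_
    have := h0 p hp
    positivity
  · refine ContDiffOn.exp (ContDiffOn.div ?_ (by fun_prop) fun p hp => ?_)
    · exact hn.neg.contDiffOn
    · have := h0 p hp
      positivity
  · refine (II_contDiffOn hh).comp (t := univ ×ˢ Ioi 0)
      (f := fun p : Ed d × ℝ => ((1 / (2 * ν * p.2)) • p.1, 1 / (4 * ν * p.2))) ?_ ?_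
    · have hq : ∀ c : ℝ, 0 < c → ContDiffOn ℝ (⊤ : ℕ∞) (fun p : Ed d × ℝ => 1 / (c * ν * p.2))
          (univ ×ˢ Ioi 0) := by
        intro c hc
        refine ContDiffOn.div (by fun_prop) (by fun_prop) fun p hp => ?_
        have := h0 p hp
        positivity
      exact ((hq 2 (by norm_num)).smul contDiffOn_fst).prodMk (hq 4 (by norm_num))
    · intro p hp
      have := h0 p hp
      refine ⟨mem_univ _, ?_⟩
      simp only [mem_Ioi]
      positivity

lemma JJ_pos {d : ℕ} {ν : ℝ} (hν : 0 < ν) {f : Ed d → ℝ} (hh : SG (fun y => Real.exp (f y)))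
    {p : Ed d × ℝ} (hp : 0 < p.2) : 0 < JJ ν (fun y => Real.exp (f y)) p := by
  unfold JJ
  have : 0 < II (fun y => Real.exp (f y)) ((1 / (2 * ν * p.2)) • p.1, 1 / (4 * ν * p.2)) := by
    have h1 := II_integrable hh ((1 / (2 * ν * p.2)) • p.1, 1 / (4 * ν * p.2))
      (by simp only; positivity)
    unfold II
    simp only [smul_eq_mul, ← Real.exp_add] at h1 ⊢
    exact integral_exp_pos h1
  positivity

lemma II_const_mul {d : ℕ} (c : ℝ) (h : Ed d → ℝ) (p : Ed d × ℝ) :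
    II (fun y => c * h y) p = c * II h p := by
  unfold II
  rw [← integral_const_mul]
  congr 1
  ext y
  simp only [smul_eq_mul]
  ring

lemma SG.coord {d : ℕ} {h : Ed d → ℝ} (hh : SG h) (i : Fin d) : SG (fun y => y i * h y) := by
  refine hh.mul_sq ?_ fun y => ?_
  · have := hh.1
    fun_prop
  · rw [norm_mul, mul_comm]
    have h1 : ‖y i‖ ≤ ‖y‖ := PiLp.norm_apply_le y i
    have h2 : ‖y‖ ≤ 1 + 2 * ‖y‖ ^ 2 := by nlinarith [sq_nonneg (‖y‖ - 1), sq_nonneg ‖y‖]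
    gcongr
    exact h1.trans h2

lemma JJ_Dx {d : ℕ} {ν : ℝ} (hν : 0 < ν) {h : Ed d → ℝ} (hh : SG h) (i : Fin d)
    (p : Ed d × ℝ) (hp : 0 < p.2) :
    fderiv ℝ (JJ ν h) p (ee i) =
      1 / (2 * ν * p.2) * (JJ ν (fun y => y i * h y) p - p.1 i * JJ ν h p) := by
  obtain ⟨x, t⟩ := p
  simp only at hp
  rw [← (D_at (JJ_smooth hν hh) (p := (x, t)) hp).lineDeriv_eq_fderiv]
  refine HasLineDerivAt.lineDeriv ?_
  unfold HasLineDerivAt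
  have hx : HasDerivAt (fun r : ℝ => x + r • EuclideanSpace.single i (1 : ℝ))
      (EuclideanSpace.single i (1 : ℝ)) 0 := by
    simpa using ((hasDerivAt_id (0 : ℝ)).smul_const (EuclideanSpace.single i (1 : ℝ))).const_add x
  have hκ : HasDerivAt (fun r : ℝ => ((1 / (2 * ν * t)) • (x + r • EuclideanSpace.single i (1 : ℝ)),
      1 / (4 * ν * t))) ((1 / (2 * ν * t)) • EuclideanSpace.single i (1 : ℝ), (0 : ℝ)) 0 :=
    (hx.const_smul (1 / (2 * ν * t))).prodMk (hasDerivAt_const _ _)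
  have hG := HasFDerivAt.comp_hasDerivAt_of_eq (f := fun r : ℝ =>
      ((1 / (2 * ν * t)) • (x + r • EuclideanSpace.single i (1 : ℝ)), 1 / (4 * ν * t))) (0 : ℝ)
    (D_at (II_contDiffOn hh) (p := ((1 / (2 * ν * t)) • x, 1 / (4 * ν * t)))
      (by simp only; positivity)).hasFDerivAt hκ (by simp)
  rw [II_fderiv hh _ (by simp only; positivity)] at hG
  have h3 : ∀ y : Ed d, phs y ((1 / (2 * ν * t)) • EuclideanSpace.single i (1 : ℝ), (0 : ℝ)) * h y
      = 1 / (2 * ν * t) * (y i * h y) := by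
    intro y
    rw [phs_apply, inner_smul_right, EuclideanSpace.inner_single_right]
    simp
    ring
  simp only [h3] at hG
  rw [II_const_mul] at hG
  have hE := ((hx.norm_sq.neg).div_const (4 * ν * t)).exp
  have := (hE.mul hG).const_mul ((4 * π * ν * t) ^ (-(d : ℝ) / 2))
  unfold JJ
  refine HasDerivAt.congr_deriv (this.congr_of_eventuallyEq (Eventually.of_forall fun r => ?_)) ?_
  · simp [mul_assoc]
  · simp [EuclideanSpace.inner_single_right]
    field_simp
    ring

lemma JJ_Dt {d : ℕ} {ν : ℝ} (hν : 0 < ν) {h : Ed d → ℝ} (hh : SG h)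
    (x : Ed d) {t : ℝ} (ht : 0 < t) :
    fderiv ℝ (JJ ν h) (x, t) (0, 1) =
      -(d : ℝ) / (2 * t) * JJ ν h (x, t) + 1 / (4 * ν * t ^ 2) *
        ∑ i : Fin d, (x i ^ 2 * JJ ν h (x, t) - 2 * x i * JJ ν (fun y => y i * h y) (x, t)
          + JJ ν (fun y => y i * (y i * h y)) (x, t)) := by
  rw [← slice_t (JJ_smooth hν hh) x ht]
  refine HasDerivAt.deriv ?_
  have h1 : HasDerivAt (fun s : ℝ => 1 / (2 * ν * s)) (-1 / (2 * ν * t ^ 2)) t := by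
    have := (hasDerivAt_inv ht.ne').const_mul (1 / (2 * ν))
    refine HasDerivAt.congr_deriv (this.congr_of_eventuallyEq (Eventually.of_forall fun r => ?_)) ?_
    · simp only; rw [one_div, one_div, mul_inv (2 * ν)]
    · field_simp
  have h2 : HasDerivAt (fun s : ℝ => 1 / (4 * ν * s)) (-1 / (4 * ν * t ^ 2)) t := by
    have := (hasDerivAt_inv ht.ne').const_mul (1 / (4 * ν))
    refine HasDerivAt.congr_deriv (this.congr_of_eventuallyEq (Eventually.of_forall fun r => ?_)) ?_
    · simp only; rw [one_div, one_div, mul_inv (4 * ν)]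
    · field_simp
  have hκ : HasDerivAt (fun s : ℝ => ((1 / (2 * ν * s)) • x, 1 / (4 * ν * s)))
      ((-1 / (2 * ν * t ^ 2)) • x, -1 / (4 * ν * t ^ 2)) t :=
    (h1.smul_const x).prodMk h2
  have hpos : 0 < ((1 / (2 * ν * t)) • x, 1 / (4 * ν * t)).2 := by simp only; positivity
  have hG := HasFDerivAt.comp_hasDerivAt (f := fun s : ℝ =>
      ((1 / (2 * ν * s)) • x, 1 / (4 * ν * s))) t
    (D_at (II_contDiffOn hh) (p := ((1 / (2 * ν * t)) • x, 1 / (4 * ν * t))) hpos).hasFDerivAt hκ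
  rw [II_fderiv hh _ hpos] at hG
  have h3 : II (fun y => phs y ((-1 / (2 * ν * t ^ 2)) • x, -1 / (4 * ν * t ^ 2)) * h y)
      ((1 / (2 * ν * t)) • x, 1 / (4 * ν * t)) = ∑ i : Fin d,
      (1 / (4 * ν * t ^ 2) * II (fun y => y i * (y i * h y))
          ((1 / (2 * ν * t)) • x, 1 / (4 * ν * t))
        - (1 / (2 * ν * t ^ 2) * x i) * II (fun y => y i * h y)
          ((1 / (2 * ν * t)) • x, 1 / (4 * ν * t))) := by
    unfold II
    simp only [← integral_const_mul]
    have hi := fun i : Fin d => ((II_integrable ((hh.coord i).coord i) _ hpos).const_mul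
      (1 / (4 * ν * t ^ 2)))
    have hj := fun i : Fin d => ((II_integrable (hh.coord i) _ hpos).const_mul
      (1 / (2 * ν * t ^ 2) * x i))
    simp only [fun i => (integral_sub (hi i) (hj i)).symm]
    refine Eq.trans ?_ (integral_finsetSum _ fun i _ => (hi i).sub (hj i))
    congr 1
    ext y
    generalize Real.exp _ = e
    rw [phs_apply _ (_ • x, _), inner_smul_right, EuclideanSpace.real_norm_sq_eq, PiLp.inner_apply]
    simp only [smul_eq_mul, Finset.mul_sum, Finset.sum_mul, ← Finset.sum_sub_distrib]
    refine Finset.sum_congr rfl fun i _ => ?_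
    simp
    field_simp
    ring
  rw [h3] at hG
  have hE : HasDerivAt (fun s : ℝ => Real.exp (-‖x‖ ^ 2 / (4 * ν * s)))
      (Real.exp (-‖x‖ ^ 2 / (4 * ν * t)) * (-‖x‖ ^ 2 * (-1 / (4 * ν * t ^ 2)))) t := by
    have := (h2.const_mul (-‖x‖ ^ 2)).exp
    simpa only [mul_one_div] using this
  have hC : HasDerivAt (fun s : ℝ => (4 * π * ν * s) ^ (-(d : ℝ) / 2))
      (-(d : ℝ) / (2 * t) * (4 * π * ν * t) ^ (-(d : ℝ) / 2)) t := by
    have h4 : HasDerivAt (fun s : ℝ => 4 * π * ν * s) (4 * π * ν) t := by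
      simpa using (hasDerivAt_id t).const_mul (4 * π * ν)
    have h5 : 0 < 4 * π * ν * t := by positivity
    refine (h4.rpow_const (p := -(d : ℝ) / 2) (Or.inl h5.ne')).congr_deriv ?_
    rw [Real.rpow_sub_one h5.ne']
    field_simp
  refine ((hC.mul hE).mul hG).congr_deriv ?_
  unfold JJ
  simp only [Pi.mul_apply, Function.comp_apply]
  rw [EuclideanSpace.real_norm_sq_eq]
  generalize (4 * π * ν * t) ^ (-(d : ℝ) / 2) = A
  generalize Real.exp (-(∑ i, x i ^ 2) / (4 * ν * t)) = B
  generalize II h ((1 / (2 * ν * t)) • x, 1 / (4 * ν * t)) = G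
  simp only [Finset.sum_add_distrib, Finset.sum_sub_distrib]
  have e1 : ∀ K : Fin d → ℝ, ∑ i, 2 * x i * (A * B * K i) = 2 * (A * B) * ∑ i, x i * K i := by
    intro K
    rw [Finset.mul_sum]
    exact Finset.sum_congr rfl fun i _ => by ring
  have e2 : ∀ K : Fin d → ℝ, ∑ i, 1 / (2 * ν * t ^ 2) * x i * K i
      = 1 / (2 * ν * t ^ 2) * ∑ i, x i * K i := by
    intro K
    rw [Finset.mul_sum]
    exact Finset.sum_congr rfl fun i _ => by ring
  rw [e1, e2, ← Finset.mul_sum, ← Finset.mul_sum, ← Finset.sum_mul]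
  field_simp
  ring

lemma heat_JJ {d : ℕ} {ν : ℝ} (hν : 0 < ν) {h : Ed d → ℝ} (hh : SG h)
    (p : Ed d × ℝ) (hp : 0 < p.2) : fderiv ℝ (JJ ν h) p (0, 1) =
      ν * ∑ j : Fin d, fderiv ℝ (fun q => fderiv ℝ (JJ ν h) q (ee j)) p (ee j) := by
  obtain ⟨x, t⟩ := p
  simp only at hp
  have key : ∀ j : Fin d, fderiv ℝ (fun q => fderiv ℝ (JJ ν h) q (ee j)) (x, t) (ee j) =
      1 / (2 * ν * t) * (1 / (2 * ν * t) * (x j ^ 2 * JJ ν h (x, t)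
        - 2 * x j * JJ ν (fun y => y j * h y) (x, t)
          + JJ ν (fun y => y j * (y j * h y)) (x, t)) - JJ ν h (x, t)) := by
    intro j
    rw [D_congr (fun q hq => JJ_Dx hν hh j q hq) hp,
      ← slice_x (f := fun q : Ed d × ℝ => 1 / (2 * ν * q.2) *
        (JJ ν (fun y => y j * h y) q - q.1 j * JJ ν h q)) ?_ x hp]
    · have e1 : ∀ {k : Ed d → ℝ}, SG k → HasFDerivAt (fun y => JJ ν k (y, t))
          (fderiv ℝ (fun y => JJ ν k (y, t)) x) x := by
        intro k hk
        refine DifferentiableAt.hasFDerivAt ?_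
        exact (D_at (JJ_smooth hν hk) (p := (x, t)) hp).comp (f := fun y : Ed d => (y, t)) x
          (by fun_prop)
      have e2 : HasFDerivAt (fun y : Ed d => y j) (EuclideanSpace.proj j : Ed d →L[ℝ] ℝ) x :=
        (EuclideanSpace.proj j : Ed d →L[ℝ] ℝ).hasFDerivAt
      have e3 := ((e1 (hh.coord j)).sub (e2.mul (e1 hh))).const_mul (1 / (2 * ν * t))
      have e4 : fderiv ℝ (fun y : Ed d => 1 / (2 * ν * t) *
        (JJ ν (fun y => y j * h y) (y, t) - y j * JJ ν h (y, t))) x = _ := e3.fderiv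
      simp only
      rw [e4]
      simp [slice_x (JJ_smooth hν hh) x hp, slice_x (JJ_smooth hν (hh.coord j)) x hp,
        JJ_Dx hν hh j (x, t) hp, JJ_Dx hν (hh.coord j) j (x, t) hp]
      left
      ring
    · exact (D_smooth (JJ_smooth hν hh) (ee j)).congr fun q hq => (JJ_Dx hν hh j q hq.2).symm
  rw [JJ_Dt hν hh x hp]
  simp only [key]
  simp only [← Finset.mul_sum, Finset.sum_sub_distrib, Finset.sum_const, Finset.card_univ,
    Fintype.card_fin, nsmul_eq_mul]
  field_simp
  ring

/-- Gaussian weight. -/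
def ww {d : ℕ} (ν : ℝ) (z : Ed d) : ℝ := Real.exp (-‖z‖ ^ 2 / (4 * ν))

lemma ww_cont {d : ℕ} (ν : ℝ) : Continuous (ww (d := d) ν) := by
  unfold ww
  fun_prop

lemma ww_pos {d : ℕ} (ν : ℝ) (z : Ed d) : 0 < ww ν z := Real.exp_pos _

lemma SG.int_ww {d : ℕ} {ν : ℝ} (hν : 0 < ν) {k : Ed d → ℝ} (hk : SG k) :
    Integrable (fun z => k z * ww ν z) := by
  obtain ⟨C, hC, hC'⟩ := hk.2 (1 / (8 * ν)) (by positivity)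
  refine integrable_of_gauss (hk.1.mul (ww_cont ν)).aestronglyMeasurable (c := 1 / (8 * ν))
    (C := C) (by positivity) fun y => ?_
  rw [norm_mul, Real.norm_of_nonneg (ww_pos ν y).le]
  calc ‖k y‖ * ww ν y ≤ (C * Real.exp (1 / (8 * ν) * ‖y‖ ^ 2)) * ww ν y := by
        have := (ww_pos ν y).le
        gcongr
        exact hC' y
    _ = _ := by
        unfold ww
        rw [mul_assoc, ← Real.exp_add]
        congr 2
        field_simp
        ring

lemma SG_const {d : ℕ} (c : ℝ) : SG (fun _ : Ed d => c) := by
  refine ⟨continuous_const, fun ε hε => ⟨‖c‖, norm_nonneg _, fun y => ?_⟩⟩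
  exact le_mul_of_one_le_right (norm_nonneg _) (Real.one_le_exp (by positivity))

lemma SG_clm {d : ℕ} (L : Ed d →L[ℝ] ℝ) : SG (fun z => L z) := by
  refine (SG_const ‖L‖).mul_sq L.continuous fun y => ?_
  rw [norm_norm]
  have h2 : ‖y‖ ≤ 1 + 2 * ‖y‖ ^ 2 := by nlinarith [sq_nonneg (‖y‖ - 1), sq_nonneg ‖y‖]
  exact (L.le_opNorm y).trans (by gcongr)

lemma SG.scale {d : ℕ} {g : Ed d → ℝ} (hg : SG g) (x : Ed d) (r : ℝ) :
    SG (fun z => g (x + r • z)) := by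
  refine ⟨hg.1.comp (by fun_prop), fun ε hε => ?_⟩
  obtain ⟨C, hC, hC'⟩ := hg.2 (ε / (2 * r ^ 2 + 2)) (by positivity)
  refine ⟨C * Real.exp (ε / (2 * r ^ 2 + 2) * (2 * ‖x‖ ^ 2)), by positivity, fun z => ?_⟩
  refine (hC' _).trans ?_
  rw [mul_assoc, ← Real.exp_add]
  gcongr
  have h1 : ‖x + r • z‖ ^ 2 ≤ 2 * ‖x‖ ^ 2 + 2 * r ^ 2 * ‖z‖ ^ 2 := by
    have : ‖x + r • z‖ ≤ ‖x‖ + |r| * ‖z‖ := by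
      simpa [norm_smul] using norm_add_le x (r • z)
    have h3 : ‖x + r • z‖ ^ 2 ≤ (‖x‖ + |r| * ‖z‖) ^ 2 := by gcongr
    have h4 : (|r| * ‖z‖) ^ 2 = r ^ 2 * ‖z‖ ^ 2 := by rw [mul_pow, sq_abs]
    nlinarith [sq_nonneg (‖x‖ - |r| * ‖z‖)]
  calc ε / (2 * r ^ 2 + 2) * ‖x + r • z‖ ^ 2
      ≤ ε / (2 * r ^ 2 + 2) * (2 * ‖x‖ ^ 2 + 2 * r ^ 2 * ‖z‖ ^ 2) := by gcongr
    _ = ε / (2 * r ^ 2 + 2) * (2 * ‖x‖ ^ 2) + ε / (2 * r ^ 2 + 2) * (2 * r ^ 2) * ‖z‖ ^ 2 := by ring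
    _ ≤ ε / (2 * r ^ 2 + 2) * (2 * ‖x‖ ^ 2) + ε * ‖z‖ ^ 2 := by
        gcongr
        rw [div_mul_eq_mul_div, div_le_iff₀ (by positivity)]
        nlinarith

lemma ww_first {d : ℕ} (ν : ℝ) (i : Fin d) : ∫ z : Ed d, z i * ww ν z = 0 := by
  have h := integral_neg_eq_self (fun z : Ed d => z i * ww ν z) volume
  have h2 : ∀ z : Ed d, (-z) i * ww ν (-z) = -(z i * ww ν z) := by
    intro z
    simp [ww]
  simp only [h2, integral_neg] at h
  linarith

lemma ww_second {d : ℕ} {ν : ℝ} (hν : 0 < ν) (L : Ed d →L[ℝ] ℝ) (i : Fin d) :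
    ∫ z : Ed d, z i * L z * ww ν z =
      2 * ν * L (EuclideanSpace.single i 1) * ∫ z : Ed d, ww ν z := by
  have hd : ∀ z : Ed d, HasFDerivAt (ww ν)
      (ww ν z • ((1 / (4 * ν)) • -((2 : ℝ) • innerSL ℝ z)) : Ed d →L[ℝ] ℝ) z := by
    intro z
    have := (((hasStrictFDerivAt_norm_sq z).hasFDerivAt.neg).mul_const (1 / (4 * ν))).exp
    refine (this.congr_of_eventuallyEq (Eventually.of_forall fun y => ?_)).congr_fderiv ?_
    · simp [ww, div_eq_mul_inv]
    · refine ContinuousLinearMap.ext fun v => ?_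
      simp [ww, div_eq_mul_inv]
  have hdi : ∀ z : Ed d, fderiv ℝ (ww ν) z (EuclideanSpace.single i 1) =
      -(1 / (2 * ν)) * (z i * ww ν z) := by
    intro z
    rw [(hd z).fderiv]
    simp [EuclideanSpace.inner_single_right]
    field_simp
    ring
  have hLi : Integrable (fun z : Ed d => L z * (z i * ww ν z)) := by
    refine (((SG_clm L).coord i).int_ww hν).congr (Eventually.of_forall fun z => ?_)
    simp only
    ring
  have key := integral_mul_fderiv_eq_neg_fderiv_mul_of_integrable (μ := volume) (𝕜 := ℝ)
    (f := fun z => L z) (g := ww ν) (v := EuclideanSpace.single i 1) ?_ ?_ ?_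
    (fun z _ => L.differentiableAt) (fun z _ => (hd z).differentiableAt)
  · simp only [hdi, ContinuousLinearMap.fderiv] at key
    rw [integral_const_mul] at key
    have e1 : ∀ z : Ed d, L z * (-(1 / (2 * ν)) * (z i * ww ν z))
        = -(1 / (2 * ν)) * (z i * L z * ww ν z) := fun z => by ring
    simp only [e1] at key
    rw [integral_const_mul] at key
    field_simp at key
    linarith
  · simp only [ContinuousLinearMap.fderiv]
    exact (SG_const _).int_ww hν
  · simp only [hdi]
    refine (hLi.const_mul (-(1 / (2 * ν)))).congr (Eventually.of_forall fun z => ?_)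
    simp only
    ring
  · exact (SG_clm L).int_ww hν

lemma JJ_scale {d : ℕ} {ν : ℝ} (hν : 0 < ν) {t : ℝ} (ht : 0 < t) : ∃ K : ℝ, 0 < K ∧
    ∀ (h : Ed d → ℝ) (x : Ed d), JJ ν h (x, t) = K * ∫ z, h (x + √t • z) * ww ν z := by
  have hr : 0 < √t := Real.sqrt_pos.2 ht
  refine ⟨(4 * π * ν * t) ^ (-(d : ℝ) / 2) * √t ^ d, by positivity, fun h x => ?_⟩
  rw [JJ_eq hν h x ht, mul_assoc (_ ^ _)]
  congr 1
  rw [← integral_add_left_eq_self _ x]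
  have := Measure.integral_comp_smul (volume : Measure (Ed d))
    (fun y => h (x + y) * Real.exp (-‖x - (x + y)‖ ^ 2 / (4 * ν * t))) (√t)
  have e : ∀ z : Ed d, Real.exp (-‖x - (x + √t • z)‖ ^ 2 / (4 * ν * t)) = ww ν z := by
    intro z
    unfold ww
    rw [sub_add_cancel_left, norm_neg, norm_smul, mul_pow, Real.norm_of_nonneg hr.le,
      Real.sq_sqrt ht.le]
    congr 1
    field_simp
  simp only [e] at this
  rw [this]
  simp only [finrank_euclideanSpace, Fintype.card_fin, smul_eq_mul]
  rw [abs_of_pos (by positivity), ← mul_assoc, mul_inv_cancel₀ (by positivity), one_mul]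

lemma growth {d : ℕ} {g : Ed d → ℝ} (hg : SG g) {x : Ed d} {g' : Ed d →L[ℝ] ℝ}
    (hd : HasFDerivAt g g' x) {ε : ℝ} (hε : 0 < ε) : ∃ C : ℝ, 0 ≤ C ∧
      ∀ v, |g (x + v) - g x| ≤ C * ‖v‖ * Real.exp (ε * ‖v‖ ^ 2) := by
  obtain ⟨M, hM0, hM⟩ := hd.isBigO_sub.exists_nonneg
  obtain ⟨δ, hδ, hδ'⟩ := Metric.eventually_nhds_iff.1 hM.bound
  obtain ⟨C, hC, hC'⟩ := (hg.scale x 1).2 ε hε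
  refine ⟨M + (C + |g x|) / δ, by positivity, fun v => ?_⟩
  have h1 : (1 : ℝ) ≤ Real.exp (ε * ‖v‖ ^ 2) := Real.one_le_exp (by positivity)
  by_cases hv : ‖v‖ < δ
  · have h2 := hδ' (y := x + v) (by simpa [dist_eq_norm] using hv)
    simp only [add_sub_cancel_left, Real.norm_eq_abs] at h2
    calc |g (x + v) - g x| ≤ M * ‖v‖ := h2
      _ ≤ (M + (C + |g x|) / δ) * ‖v‖ := by gcongr; exact le_add_of_nonneg_right (by positivity)
      _ ≤ _ := le_mul_of_one_le_right (by positivity) h1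
  · push Not at hv
    have h2 := hC' v
    simp only [one_smul, Real.norm_eq_abs] at h2
    have h3 : 1 ≤ ‖v‖ / δ := (one_le_div hδ).2 hv
    have h4 : |g x| ≤ |g x| * Real.exp (ε * ‖v‖ ^ 2) :=
      le_mul_of_one_le_right (abs_nonneg _) h1
    calc |g (x + v) - g x| ≤ |g (x + v)| + |g x| := abs_sub _ _
      _ ≤ (C + |g x|) * Real.exp (ε * ‖v‖ ^ 2) := by linarith
      _ ≤ ((C + |g x|) * Real.exp (ε * ‖v‖ ^ 2)) * (‖v‖ / δ) :=
          le_mul_of_one_le_right (by positivity) h3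
      _ = ((C + |g x|) / δ) * ‖v‖ * Real.exp (ε * ‖v‖ ^ 2) := by ring
      _ ≤ _ := by gcongr; exact le_add_of_nonneg_left hM0

lemma lim_num {d : ℕ} {ν : ℝ} (hν : 0 < ν) {g : Ed d → ℝ} (hg : SG g) {x : Ed d}
    {g' : Ed d →L[ℝ] ℝ} (hd : HasFDerivAt g g' x) (i : Fin d) :
    Tendsto (fun r : ℝ => ∫ z, z i * ((g (x + r • z) - g x) / r) * ww ν z) (𝓝[>] 0)
      (𝓝 (∫ z, z i * g' z * ww ν z)) := by
  obtain ⟨C, hC, hC'⟩ := growth hg hd (ε := 1 / (16 * ν)) (by positivity)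
  have hev : ∀ᶠ r : ℝ in 𝓝[>] 0, 0 < r ∧ r ≤ 1 := by
    filter_upwards [Ioc_mem_nhdsGT (zero_lt_one' ℝ)] with r hr using hr
  refine tendsto_integral_filter_of_dominated_convergence
    (fun z => C * (16 * ν) * Real.exp (-(1 / (8 * ν)) * ‖z‖ ^ 2)) ?_ ?_ ?_ ?_
  · refine Eventually.of_forall fun r => Continuous.aestronglyMeasurable ?_
    have h1 := (hg.scale x r).1
    have h2 := ww_cont (d := d) ν
    have h3 : Continuous (fun z : Ed d => z i) := by fun_prop
    exact (h3.mul ((h1.sub continuous_const).div_const r)).mul h2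
  · filter_upwards [hev] with r hr
    refine Eventually.of_forall fun z => ?_
    have hr0 := hr.1
    have h1 : |(g (x + r • z) - g x) / r| ≤ C * ‖z‖ * Real.exp (1 / (16 * ν) * ‖z‖ ^ 2) := by
      rw [abs_div, abs_of_pos hr0, div_le_iff₀ hr0]
      have h2 := hC' (r • z)
      rw [norm_smul, Real.norm_of_nonneg hr0.le] at h2
      have h3 : r * ‖z‖ ≤ ‖z‖ := mul_le_of_le_one_left (norm_nonneg _) hr.2
      calc _ ≤ _ := h2
        _ ≤ C * (r * ‖z‖) * Real.exp (1 / (16 * ν) * ‖z‖ ^ 2) := by gcongr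
        _ = _ := by ring
    have h2 : |z i| ≤ ‖z‖ := PiLp.norm_apply_le z i
    rw [Real.norm_eq_abs, abs_mul, abs_mul, abs_of_pos (ww_pos ν z)]
    have h4 := sq_le_exp_sq (1 / (16 * ν)) ‖z‖ (by positivity)
    have h5 := (ww_pos ν z).le
    calc |z i| * |(g (x + r • z) - g x) / r| * ww ν z
        ≤ ‖z‖ * (C * ‖z‖ * Real.exp (1 / (16 * ν) * ‖z‖ ^ 2)) * ww ν z := by gcongr
      _ = C * ‖z‖ ^ 2 * Real.exp (1 / (16 * ν) * ‖z‖ ^ 2) * ww ν z := by ring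
      _ ≤ C * ((1 / (16 * ν))⁻¹ * Real.exp (1 / (16 * ν) * ‖z‖ ^ 2)) *
            Real.exp (1 / (16 * ν) * ‖z‖ ^ 2) * ww ν z := by gcongr
      _ = C * (16 * ν) * (Real.exp (1 / (16 * ν) * ‖z‖ ^ 2) *
            Real.exp (1 / (16 * ν) * ‖z‖ ^ 2) * ww ν z) := by
            rw [one_div, inv_inv]; ring
      _ = _ := by
            unfold ww
            rw [← Real.exp_add, ← Real.exp_add]
            congr 2
            field_simp
            ring
  · exact (integrable_gauss (by positivity)).const_mul _
  · refine Eventually.of_forall fun z => ?_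
    have h1 : HasDerivAt (fun r : ℝ => g (x + r • z)) (g' z) 0 := hd.hasLineDerivAt z
    have h2 := (hasDerivAt_iff_tendsto_slope_zero.1 h1).mono_left
      (nhdsWithin_mono 0 (fun r (hr : 0 < r) => ne_of_gt hr) : 𝓝[>] (0 : ℝ) ≤ 𝓝[≠] 0)
    have h3 : Tendsto (fun r : ℝ => (g (x + r • z) - g x) / r) (𝓝[>] 0) (𝓝 (g' z)) := by
      refine h2.congr fun r => ?_
      simp only [zero_add, zero_smul, add_zero, smul_eq_mul]
      ring
    exact (h3.const_mul (z i)).mul_const (ww ν z)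

lemma lim_den {d : ℕ} {ν : ℝ} (hν : 0 < ν) {g : Ed d → ℝ} (hg : SG g) (x : Ed d) :
    Tendsto (fun r : ℝ => ∫ z, g (x + r • z) * ww ν z) (𝓝[>] 0)
      (𝓝 (g x * ∫ z : Ed d, ww ν z)) := by
  obtain ⟨C, hC, hC'⟩ := (hg.scale x 1).2 (1 / (8 * ν)) (by positivity)
  have hev : ∀ᶠ r : ℝ in 𝓝[>] 0, 0 < r ∧ r ≤ 1 := by
    filter_upwards [Ioc_mem_nhdsGT (zero_lt_one' ℝ)] with r hr using hr
  rw [← integral_const_mul]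
  refine tendsto_integral_filter_of_dominated_convergence
    (fun z => C * Real.exp (-(1 / (8 * ν)) * ‖z‖ ^ 2)) ?_ ?_ ?_ ?_
  · refine Eventually.of_forall fun r => Continuous.aestronglyMeasurable ?_
    exact (hg.scale x r).1.mul (ww_cont (d := d) ν)
  · filter_upwards [hev] with r hr
    refine Eventually.of_forall fun z => ?_
    have h1 := hC' (r • z)
    simp only [one_smul] at h1
    rw [norm_smul, Real.norm_of_nonneg hr.1.le] at h1
    have h3 : r * ‖z‖ ≤ ‖z‖ := mul_le_of_le_one_left (norm_nonneg _) hr.2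
    have h5 := (ww_pos ν z).le
    have hr0 := hr.1
    rw [norm_mul, Real.norm_of_nonneg h5]
    calc ‖g (x + r • z)‖ * ww ν z ≤ (C * Real.exp (1 / (8 * ν) * (r * ‖z‖) ^ 2)) * ww ν z := by
          gcongr
      _ ≤ (C * Real.exp (1 / (8 * ν) * ‖z‖ ^ 2)) * ww ν z := by gcongr
      _ = _ := by
        unfold ww
        rw [mul_assoc, ← Real.exp_add]
        congr 2
        field_simp
        ring
  · exact (integrable_gauss (by positivity)).const_mul _
  · refine Eventually.of_forall fun z => ?_
    refine Tendsto.mul_const _ ?_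
    have h1 : Continuous (fun r : ℝ => g (x + r • z)) := hg.1.comp (by fun_prop)
    have h2 := (h1.tendsto 0).mono_left (nhdsWithin_le_nhds (s := Ioi 0))
    simpa using h2

lemma quot_eq {d : ℕ} {ν : ℝ} (hν : 0 < ν) {g : Ed d → ℝ} (hg : SG g) (x : Ed d) (i : Fin d)
    {t : ℝ} (ht : 0 < t) :
    -2 * ν * (fderiv ℝ (JJ ν g) (x, t) (ee i) / JJ ν g (x, t)) =
      -(∫ z, z i * ((g (x + √t • z) - g x) / √t) * ww ν z) / ∫ z, g (x + √t • z) * ww ν z := by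
  obtain ⟨K, hK, hK'⟩ := JJ_scale (d := d) hν ht
  have hr : 0 < √t := Real.sqrt_pos.2 ht
  have hrt : √t * √t = t := Real.mul_self_sqrt ht.le
  rw [JJ_Dx hν hg i (x, t) ht, hK', hK']
  have i1 := (hg.scale x √t).int_ww hν
  have i2 := ((hg.scale x √t).coord i).int_ww hν
  have i3 := ((SG_const (d := d) (g x)).coord i).int_ww hν
  have e1 : ∫ z, (x + √t • z) i * g (x + √t • z) * ww ν z
      = x i * (∫ z, g (x + √t • z) * ww ν z) + √t * ∫ z, z i * g (x + √t • z) * ww ν z := by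
    rw [← integral_const_mul, ← integral_const_mul, ← integral_add (i1.const_mul _) (i2.const_mul _)]
    congr 1
    ext z
    simp
    ring
  have e2 : ∫ z, z i * ((g (x + √t • z) - g x) / √t) * ww ν z
      = (√t)⁻¹ * ∫ z, z i * g (x + √t • z) * ww ν z := by
    have e3 : ∫ z : Ed d, z i * g x * ww ν z = 0 := by
      have : ∀ z : Ed d, z i * g x * ww ν z = g x * (z i * ww ν z) := fun z => by ring
      simp only [this]
      rw [integral_const_mul, ww_first, mul_zero]
    have e4 := integral_sub i2 i3
    rw [e3, sub_zero] at e4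
    rw [← e4, ← integral_const_mul]
    congr 1
    ext z
    field_simp
  rw [e1, e2]
  simp only
  generalize ∫ z, z i * g (x + √t • z) * ww ν z = P
  generalize ∫ z, g (x + √t • z) * ww ν z = Q
  generalize √t = r at *
  subst hrt
  by_cases hQ : Q = 0
  · simp [hQ]
  field_simp
  ring

/-- Hopf–Cole solution of the Burgers equation in arbitrary dimension:
`v(x,t) := ∇ₓ(−2ν ln b₀(x,t))` is smooth on `ℝ^d × (0,∞)`, solves the Burgers equation
`∂ₜv + (v·∇)v = νΔv` componentwise there, and if `Θ₀` is continuously differentiable then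
`v(x,t) → ∇Θ₀(x)` as `t → 0⁺` for every `x`. -/
theorem statement8 (d : ℕ) (hd : 1 ≤ d) (ν : ℝ) (hν : 0 < ν)
    (Θ₀ : Ed d → ℝ) (hΘ₀cont : Continuous Θ₀) (hΘ₀dec : SubQuadratic Θ₀) :
    ContDiffOn ℝ (⊤ : ℕ∞)
        (fun p : Ed d × ℝ => gradient (fun y => -2 * ν * Real.log (b0 ν Θ₀ y p.2)) p.1)
        (univ ×ˢ Ioi 0) ∧
      (∀ (x : Ed d) (t : ℝ), 0 < t → ∀ i : Fin d,
        deriv (fun s => gradient (fun y => -2 * ν * Real.log (b0 ν Θ₀ y s)) x i) t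
            + ∑ j : Fin d, gradient (fun y => -2 * ν * Real.log (b0 ν Θ₀ y t)) x j
                * fderiv ℝ
                    (fun y => gradient (fun z => -2 * ν * Real.log (b0 ν Θ₀ z t)) y i) x
                    (EuclideanSpace.single j 1)
          = ν * lap (fun y => gradient (fun z => -2 * ν * Real.log (b0 ν Θ₀ z t)) y i) x) ∧
      (ContDiff ℝ 1 Θ₀ → ∀ x : Ed d,
        Tendsto (fun t => gradient (fun y => -2 * ν * Real.log (b0 ν Θ₀ y t)) x)
          (nhdsWithin 0 (Ioi 0)) (nhds (gradient Θ₀ x))) := by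
  have hg : SG (fun y => Real.exp (-Θ₀ y / (2 * ν))) := SG_g hν hΘ₀cont hΘ₀dec
  set g : Ed d → ℝ := fun y => Real.exp (-Θ₀ y / (2 * ν)) with hgdef
  have hJpos : ∀ p : Ed d × ℝ, 0 < p.2 → 0 < JJ ν g p := fun p hp => JJ_pos hν hg hp
  have hJ := JJ_smooth hν hg
  set θ : Ed d × ℝ → ℝ := fun p => -2 * ν * Real.log (JJ ν g p) with hθdef
  have hθ : ContDiffOn ℝ (⊤ : ℕ∞) θ (univ ×ˢ Ioi 0) :=
    contDiffOn_const.mul (hJ.log fun p hp => (hJpos p hp.2).ne')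
  have hslice : ∀ t : ℝ, 0 < t →
      (fun y => -2 * ν * Real.log (b0 ν Θ₀ y t)) = fun y => θ (y, t) := by
    intro t ht
    ext y
    rw [b0_eq hν Θ₀ y ht]
  have hcoord : ∀ (x : Ed d) (t : ℝ), 0 < t → ∀ i : Fin d,
      gradient (fun y => -2 * ν * Real.log (b0 ν Θ₀ y t)) x i = fderiv ℝ θ (x, t) (ee i) := by
    intro x t ht i
    rw [gradient_coord, hslice t ht, slice_x hθ x ht]
  refine ⟨?_, ?_, ?_⟩
  · rw [contDiffOn_euclidean]
    intro i
    exact (D_smooth hθ (ee i)).congr fun p hp => hcoord p.1 p.2 hp.2 i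
  · intro x t ht i
    have hHJ := HJ hν (u := JJ ν g) hθ (fun p hp => by
      have : -(2 * ν)⁻¹ * θ p = Real.log (JJ ν g p) := by
        simp only [hθdef]
        field_simp
      rw [this, Real.exp_log (hJpos p hp)]) (heat_JJ hν hg)
    have hB := burgers hθ hHJ (x, t) ht i
    have hfun : (fun y => gradient (fun z => -2 * ν * Real.log (b0 ν Θ₀ z t)) y i)
        = fun y => (fun q => fderiv ℝ θ q (ee i)) (y, t) := by
      ext y
      exact hcoord y t ht i
    have hDi := D_smooth hθ (ee i)
    have h1 : deriv (fun s => gradient (fun y => -2 * ν * Real.log (b0 ν Θ₀ y s)) x i) t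
        = fderiv ℝ (fun q => fderiv ℝ θ q (ee i)) (x, t) (0, 1) := by
      rw [← slice_t hDi x ht]
      refine Filter.EventuallyEq.deriv_eq ?_
      filter_upwards [Ioi_mem_nhds ht] with s hs using hcoord x s hs i
    rw [h1, hfun]
    unfold lap
    have h2 : ∀ (y : Ed d) (j : Fin d),
        fderiv ℝ (fun y => (fun q => fderiv ℝ θ q (ee i)) (y, t)) y (EuclideanSpace.single j 1)
        = fderiv ℝ (fun q => fderiv ℝ θ q (ee i)) (y, t) (ee j) :=
      fun y j => slice_x hDi y ht _
    have h3 : ∀ j : Fin d, fderiv ℝ (fun y => fderiv ℝ (fun y => (fun q => fderiv ℝ θ q (ee i))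
        (y, t)) y (EuclideanSpace.single j 1)) x (EuclideanSpace.single j 1)
        = fderiv ℝ (fun q' => fderiv ℝ (fun q => fderiv ℝ θ q (ee i)) q' (ee j)) (x, t) (ee j) := by
      intro j
      rw [← slice_x (D_smooth hDi (ee j)) x ht]
      simp only [h2]
    simp only [h3]
    rw [← hB]
    congr 1
    refine Finset.sum_congr rfl fun j _ => ?_
    rw [h2, hcoord x t ht j]
  · intro hC x
    have hΘd : HasFDerivAt Θ₀ (fderiv ℝ Θ₀ x) x :=
      (hC.differentiable (by simp) x).hasFDerivAt
    have hgd : HasFDerivAt g (g x • (-(1 / (2 * ν))) • fderiv ℝ Θ₀ x) x := by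
      have := (hΘd.const_mul (-(1 / (2 * ν)))).exp
      refine (this.congr_of_eventuallyEq (Eventually.of_forall fun y => ?_)).congr_fderiv ?_
      · simp only [hgdef]
        congr 1
        ring
      · simp only [hgdef]
        congr 2
        ring
    have hgx : 0 < g x := Real.exp_pos _
    have hw : 0 < ∫ z : Ed d, ww ν z := by
      have := (SG_const (d := d) 1).int_ww hν
      simp only [one_mul] at this
      exact integral_exp_pos this
    have hsq : Tendsto (fun t : ℝ => √t) (𝓝[>] 0) (𝓝[>] 0) := by
      refine tendsto_nhdsWithin_iff.2 ⟨?_, ?_⟩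
      · have := (Real.continuous_sqrt.tendsto 0).mono_left (nhdsWithin_le_nhds (s := Ioi 0))
        simpa using this
      · filter_upwards [self_mem_nhdsWithin] with t ht using Real.sqrt_pos.2 ht
    have hlim : ∀ i : Fin d, Tendsto
        (fun t => gradient (fun y => -2 * ν * Real.log (b0 ν Θ₀ y t)) x i) (𝓝[>] 0)
        (𝓝 (gradient Θ₀ x i)) := by
      intro i
      have h1 := (((lim_num hν hg hgd i).neg).div (lim_den hν hg x) (by positivity)).comp hsq
      rw [ww_second hν] at h1
      have h2 : -(2 * ν * (g x • (-(1 / (2 * ν))) • fderiv ℝ Θ₀ x) (EuclideanSpace.single i 1)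
          * ∫ z : Ed d, ww ν z) / (g x * ∫ z : Ed d, ww ν z) = gradient Θ₀ x i := by
        rw [gradient_coord]
        simp
        field_simp
      rw [h2] at h1
      refine h1.congr' ?_
      filter_upwards [self_mem_nhdsWithin] with t ht
      have ht' : 0 < t := ht
      rw [hcoord x t ht' i]
      have h3 : fderiv ℝ θ (x, t) (ee i)
          = -2 * ν * (fderiv ℝ (JJ ν g) (x, t) (ee i) / JJ ν g (x, t)) := by
        have := ((D_at hJ (p := (x, t)) ht').hasFDerivAt.log
          (hJpos (x, t) ht').ne').const_mul (-2 * ν)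
        rw [hθdef, this.fderiv]
        simp only [smul_apply, smul_eq_mul]
        ring
      rw [h3, quot_eq hν hg x i ht']
      simp
    have h4 := (PiLp.continuous_toLp 2 (fun _ : Fin d => ℝ)).tendsto
      (fun i => gradient Θ₀ x i)
    have h5 := h4.comp (tendsto_pi_nhds.2 hlim)
    exact h5
end
end

section
/- Initial conditions for the reaction–diffusion model: for any constant k ∈ ℝ and every x ∈ ℝ^d, one has −2ν ln(b₀(x,t) − k t a₀(x,t)) → Θ₀(x) and a₀(x,t)/(b₀(x,t) − k t a₀(x,t)) → C₀(x) as t → 0⁺ (the expressions being well defined for all sufficiently small t > 0 since b₀(x,t) − k t a₀(x,t) → 1 · e^{−Θ₀(x)/(2ν)} · e^{Θ₀(x)/(2ν)} > 0 in the sense that b₀(x,t) e^{Θ₀(x)/(2ν)} → 1 and t a₀(x,t) e^{Θ₀(x)/(2ν)} → 0). -/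
open MeasureTheory Real Filter Set

noncomputable section

lemma gauss_integrable {d : ℕ} {b : ℝ} (hb : 0 < b) :
    Integrable (fun z : Ed d => Real.exp (-b * ‖z‖ ^ 2)) := by
  by_contra h
  have h1 := integral_undef h
  rw [GaussianFourier.integral_rexp_neg_mul_sq_norm hb] at h1
  have : 0 < (π / b) ^ ((Module.finrank ℝ (Ed d) : ℝ) / 2) := by positivity
  linarith

lemma subquad_bound {d : ℕ} {f : Ed d → ℝ} (hf : Continuous f) (h : SubQuadratic f) :
    ∃ M : ℝ, ∀ y, |f y| ≤ M + ‖y‖ ^ 2 := by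
  have h1 : ∀ᶠ y in cocompact (Ed d), |f y / ‖y‖ ^ 2| < 1 := by
    have := (tendsto_order.1 h.abs).2 1 (by simp)
    exact this
  obtain ⟨K, hK, hKs⟩ := mem_cocompact.1 h1
  obtain ⟨M, hM⟩ := hK.exists_bound_of_continuousOn hf.continuousOn
  refine ⟨max M 0 + |f 0|, fun y => ?_⟩
  have hm1 := le_max_left M 0
  have hm2 := le_max_right M 0
  have h0 := abs_nonneg (f 0)
  by_cases hy : y ∈ K
  · have := hM y hy
    rw [Real.norm_eq_abs] at this
    nlinarith [sq_nonneg ‖y‖]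
  · by_cases hy0 : y = 0
    · subst hy0; simp
    have hpos : 0 < ‖y‖ ^ 2 := by have := norm_pos_iff.2 hy0; positivity
    have h2 : |f y / ‖y‖ ^ 2| < 1 := hKs hy
    rw [abs_div, abs_of_pos hpos, div_lt_one hpos] at h2
    linarith

lemma heat_subst {d : ℕ} {ν t : ℝ} (hν : 0 < ν) (ht : 0 < t) (F : Ed d → ℝ) (x : Ed d) :
    (4 * π * ν * t) ^ (-(d : ℝ) / 2) * ∫ y, F y * Real.exp (-(1 / (4 * ν * t)) * ‖x - y‖ ^ 2)
      = (4 * π * ν) ^ (-(d : ℝ) / 2) *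
        ∫ z, F (x + √t • z) * Real.exp (-(1 / (4 * ν)) * ‖z‖ ^ 2) := by
  have hs : 0 < √t := Real.sqrt_pos.2 ht
  rw [← integral_add_left_eq_self
    (fun y => F y * Real.exp (-(1 / (4 * ν * t)) * ‖x - y‖ ^ 2)) x]
  have h := Measure.integral_comp_smul (volume : Measure (Ed d))
    (fun y => F (x + y) * Real.exp (-(1 / (4 * ν * t)) * ‖x - (x + y)‖ ^ 2)) (√t)
  have h2 : ∀ z : Ed d, -(1 / (4 * ν * t)) * ‖x - (x + √t • z)‖ ^ 2
      = -(1 / (4 * ν)) * ‖z‖ ^ 2 := by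
    intro z
    have : x - (x + √t • z) = -(√t • z) := by abel
    rw [this, norm_neg, norm_smul, mul_pow, Real.norm_eq_abs, sq_abs, Real.sq_sqrt ht.le]
    field_simp
  simp only [h2] at h
  rw [h, Real.mul_rpow (by positivity) ht.le, smul_eq_mul, abs_of_pos (by positivity)]
  have h3 : t ^ (-(d : ℝ) / 2) = (√t ^ Module.finrank ℝ (Ed d))⁻¹ := by
    rw [finrank_euclideanSpace_fin, Real.sqrt_eq_rpow, ← Real.rpow_natCast, ← Real.rpow_mul ht.le,
      ← Real.rpow_neg ht.le]
    congr 1; ring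
  rw [h3]; ring

lemma heat_tendsto {d : ℕ} {ν : ℝ} (hν : 0 < ν) {F : Ed d → ℝ} (hF : Continuous F)
    {A B : ℝ} (hB : 0 < B) (hFb : ∀ y, |F y| ≤ Real.exp (A + B * ‖y‖ ^ 2)) (x : Ed d) :
    Tendsto (fun t => (4 * π * ν * t) ^ (-(d : ℝ) / 2) *
      ∫ y, F y * Real.exp (-(1 / (4 * ν * t)) * ‖x - y‖ ^ 2))
      (nhdsWithin 0 (Ioi 0)) (nhds (F x)) := by
  have hlim : Tendsto (fun t => ∫ z, F (x + √t • z) * Real.exp (-(1 / (4 * ν)) * ‖z‖ ^ 2))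
      (nhdsWithin 0 (Ioi 0)) (nhds (∫ z : Ed d, F x * Real.exp (-(1 / (4 * ν)) * ‖z‖ ^ 2))) := by
    refine tendsto_integral_filter_of_dominated_convergence
      (fun z => Real.exp (A + 2 * B * ‖x‖ ^ 2) * Real.exp (-(1 / (8 * ν)) * ‖z‖ ^ 2)) ?_ ?_ ?_ ?_
    · refine Eventually.of_forall fun t => Continuous.aestronglyMeasurable ?_
      fun_prop
    · have hT : 0 < 1 / (16 * ν * B) := by positivity
      filter_upwards [Ioo_mem_nhdsGT hT] with t ht
      refine Eventually.of_forall fun z => ?_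
      rw [norm_mul, Real.norm_eq_abs, Real.norm_eq_abs, Real.abs_exp]
      refine (mul_le_mul_of_nonneg_right (hFb _) (Real.exp_pos _).le).trans ?_
      rw [← Real.exp_add, ← Real.exp_add, Real.exp_le_exp]
      have h1 : ‖x + √t • z‖ ^ 2 ≤ 2 * ‖x‖ ^ 2 + 2 * (t * ‖z‖ ^ 2) := by
        have h := norm_add_le x (√t • z)
        rw [norm_smul, Real.norm_eq_abs, abs_of_nonneg (Real.sqrt_nonneg t)] at h
        have h' : t * ‖z‖ ^ 2 = (√t * ‖z‖) ^ 2 := by rw [mul_pow, Real.sq_sqrt ht.1.le]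
        rw [h']
        nlinarith [sq_nonneg (‖x‖ - √t * ‖z‖), norm_nonneg (x + √t • z)]
      have h2 : 2 * B * t ≤ 1 / (8 * ν) := by
        have := mul_le_mul_of_nonneg_left ht.2.le (by positivity : 0 ≤ 2 * B)
        refine this.trans (le_of_eq ?_)
        field_simp; norm_num
      have h3 : 1 / (4 * ν) = 2 * (1 / (8 * ν)) := by field_simp; norm_num
      have h4 := mul_le_mul_of_nonneg_right h2 (sq_nonneg ‖z‖)
      have h5 := mul_le_mul_of_nonneg_left h1 hB.le
      rw [h3]
      linarith
    · exact (gauss_integrable (by positivity)).const_mul _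
    · refine Eventually.of_forall fun z => ?_
      have hc : Continuous (fun t : ℝ => F (x + √t • z) * Real.exp (-(1 / (4 * ν)) * ‖z‖ ^ 2)) := by
        fun_prop
      have := hc.tendsto 0
      simp only [Real.sqrt_zero, zero_smul, add_zero] at this
      exact this.mono_left nhdsWithin_le_nhds
  have h2 := hlim.const_mul ((4 * π * ν) ^ (-(d : ℝ) / 2))
  have hval : (4 * π * ν) ^ (-(d : ℝ) / 2) *
      (∫ z : Ed d, F x * Real.exp (-(1 / (4 * ν)) * ‖z‖ ^ 2)) = F x := by
    rw [integral_const_mul, GaussianFourier.integral_rexp_neg_mul_sq_norm (by positivity),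
      finrank_euclideanSpace_fin]
    have h3 : π / (1 / (4 * ν)) = 4 * π * ν := by field_simp
    rw [h3, neg_div, Real.rpow_neg (by positivity)]
    have : (4 * π * ν) ^ ((d : ℝ) / 2) ≠ 0 := by positivity
    field_simp
  rw [hval] at h2
  refine h2.congr' ?_
  filter_upwards [self_mem_nhdsWithin] with t ht
  exact (heat_subst hν ht F x).symm

/-- Initial conditions for the reaction–diffusion model: for any `k ∈ ℝ` and `x ∈ ℝ^d`,
as `t → 0⁺` one has `b₀(x,t) e^{Θ₀(x)/(2ν)} → 1` and `t a₀(x,t) e^{Θ₀(x)/(2ν)} → 0`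
(so `b₀ − k t a₀ > 0` for all small `t > 0`), and moreover
`−2ν ln(b₀(x,t) − k t a₀(x,t)) → Θ₀(x)` and `a₀(x,t)/(b₀(x,t) − k t a₀(x,t)) → C₀(x)`. -/
theorem statement18 (d : ℕ) (hd : 1 ≤ d) (ν : ℝ) (hν : 0 < ν)
    (Θ₀ : Ed d → ℝ) (hΘ₀cont : Continuous Θ₀) (hΘ₀dec : SubQuadratic Θ₀)
    (C₀ : Ed d → ℝ) (hC₀cont : Continuous C₀) (hC₀dec : SubQuadratic C₀)
    (k : ℝ) (x : Ed d) :
    Tendsto (fun t => b0 ν Θ₀ x t * Real.exp (Θ₀ x / (2 * ν)))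
        (nhdsWithin 0 (Ioi 0)) (nhds 1) ∧
      Tendsto (fun t => t * a0 ν Θ₀ C₀ x t * Real.exp (Θ₀ x / (2 * ν)))
        (nhdsWithin 0 (Ioi 0)) (nhds 0) ∧
      Tendsto (fun t => -2 * ν * Real.log (b0 ν Θ₀ x t - k * t * a0 ν Θ₀ C₀ x t))
        (nhdsWithin 0 (Ioi 0)) (nhds (Θ₀ x)) ∧
      Tendsto (fun t => a0 ν Θ₀ C₀ x t / (b0 ν Θ₀ x t - k * t * a0 ν Θ₀ C₀ x t))
        (nhdsWithin 0 (Ioi 0)) (nhds (C₀ x)) := by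
  obtain ⟨M, hM⟩ := subquad_bound hΘ₀cont hΘ₀dec
  obtain ⟨N, hN⟩ := subquad_bound hC₀cont hC₀dec
  have hexp : ∀ y t, Real.exp (-Phi Θ₀ x y t / (2 * ν))
      = Real.exp (-Θ₀ y / (2 * ν)) * Real.exp (-(1 / (4 * ν * t)) * ‖x - y‖ ^ 2) := by
    intro y t
    rw [← Real.exp_add]
    congr 1
    unfold Phi
    rcases eq_or_ne t 0 with rfl | ht
    · simp
    · field_simp; ring
  have hE : ∀ y, Real.exp (-Θ₀ y / (2 * ν))
      ≤ Real.exp (M / (2 * ν) + 1 / (2 * ν) * ‖y‖ ^ 2) := by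
    intro y
    rw [Real.exp_le_exp]
    have h1 : -Θ₀ y ≤ M + ‖y‖ ^ 2 := (neg_le_abs _).trans (hM y)
    calc -Θ₀ y / (2 * ν) ≤ (M + ‖y‖ ^ 2) / (2 * ν) := by gcongr
      _ = _ := by ring
  have hb : Tendsto (fun t => b0 ν Θ₀ x t) (nhdsWithin 0 (Ioi 0))
      (nhds (Real.exp (-Θ₀ x / (2 * ν)))) := by
    have := heat_tendsto hν (F := fun y => Real.exp (-Θ₀ y / (2 * ν))) (by fun_prop)
      (A := M / (2 * ν)) (B := 1 / (2 * ν)) (by positivity)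
      (fun y => by rw [Real.abs_exp]; exact hE y) x
    simp only [b0, hexp]
    exact this
  have ha : Tendsto (fun t => a0 ν Θ₀ C₀ x t) (nhdsWithin 0 (Ioi 0))
      (nhds (C₀ x * Real.exp (-Θ₀ x / (2 * ν)))) := by
    have := heat_tendsto hν (F := fun y => C₀ y * Real.exp (-Θ₀ y / (2 * ν))) (by fun_prop)
      (A := N + M / (2 * ν)) (B := 1 + 1 / (2 * ν)) (by positivity)
      (fun y => by
        rw [abs_mul, Real.abs_exp]
        have h1 : |C₀ y| ≤ Real.exp (N + ‖y‖ ^ 2) := by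
          have := Real.add_one_le_exp (N + ‖y‖ ^ 2)
          linarith [hN y]
        calc _ ≤ Real.exp (N + ‖y‖ ^ 2) * Real.exp (M / (2 * ν) + 1 / (2 * ν) * ‖y‖ ^ 2) := by
              gcongr
              exact Real.exp_le_exp.1 (hE y)
          _ = _ := by rw [← Real.exp_add]; congr 1; ring) x
    simp only [a0, hexp, ← mul_assoc] at this ⊢
    exact this
  have ht : Tendsto (fun t : ℝ => t) (nhdsWithin 0 (Ioi 0)) (nhds 0) :=
    tendsto_id.mono_left nhdsWithin_le_nhds
  have hden : Tendsto (fun t => b0 ν Θ₀ x t - k * t * a0 ν Θ₀ C₀ x t) (nhdsWithin 0 (Ioi 0))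
      (nhds (Real.exp (-Θ₀ x / (2 * ν)))) := by
    simpa using hb.sub ((ht.const_mul k).mul ha)
  have hpos := Real.exp_pos (-Θ₀ x / (2 * ν))
  refine ⟨?_, ?_, ?_, ?_⟩
  · have := hb.mul_const (Real.exp (Θ₀ x / (2 * ν)))
    rwa [← Real.exp_add, neg_div, neg_add_cancel, Real.exp_zero] at this
  · simpa using (ht.mul ha).mul_const (Real.exp (Θ₀ x / (2 * ν)))
  · have := (hden.log hpos.ne').const_mul (-2 * ν)
    rw [Real.log_exp] at this
    convert this using 2
    field_simp
  · have := ha.div hden hpos.ne'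
    rwa [mul_div_cancel_right₀ _ hpos.ne'] at this
end
end
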